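/- Let G be a directed graph, let D ≥ 0 be an integer, and let u, v, w be vertices with d(v→u) ≥ D, 3·d(u→w) ≥ D and 3·d(w→v) ≥ D. Then 3·min{d(u→w), d(w→u)} ≥ D or 3·min{d(w→v), d(v→w)} ≥ D; in particular, the min-eccentricity of w is at least D/3. -/

import Mathlib

/-- `HasWalk E u v n`: there is a directed walk with `n` arcs from `u` to `v`. -/
def HasWalk {V : Type*} (E : V → V → Prop) : V → V → ℕ → Prop
  | u, v, 0 => u = v
  | u, v, n + 1 => ∃ w, E u w ∧ HasWalk E w v n

/-- Directed shortest-path distance: the number of arcs in a shortest directed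
path from `u` to `v`, and `∞` if there is no such path. -/
noncomputable def ddist {V : Type*} (E : V → V → Prop) (u v : V) : ℕ∞ :=
  ⨅ (n : ℕ) (_ : HasWalk E u v n), (n : ℕ∞)

theorem HasWalk.append {V : Type*} {E : V → V → Prop} {u v w : V} {m n : ℕ}
    (h : HasWalk E u v m) (h' : HasWalk E v w n) : HasWalk E u w (m + n) := by
  induction m generalizing u with
  | zero =>
    obtain rfl : u = v := h
    simpa using h'
  | succ m ih =>
    obtain ⟨x, hx, hw⟩ := h
    rw [Nat.succ_add]
    exact ⟨x, hx, ih hw⟩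

theorem ddist_le_of_hasWalk {V : Type*} {E : V → V → Prop} {u v : V} {n : ℕ}
    (h : HasWalk E u v n) : ddist E u v ≤ n :=
  iInf₂_le n h

theorem exists_hasWalk_lt_of_ddist_lt {V : Type*} {E : V → V → Prop} {u v : V} {b : ℕ∞}
    (h : ddist E u v < b) : ∃ n : ℕ, HasWalk E u v n ∧ (n : ℕ∞) < b := by
  simpa only [ddist, iInf_lt_iff, exists_prop] using h

theorem exists_hasWalk_of_three_mul_ddist_lt {V : Type*} {E : V → V → Prop} {u v : V} {D : ℕ}
    (h : 3 * ddist E u v < D) : ∃ n : ℕ, HasWalk E u v n ∧ 3 * n < D := by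
  have hne : ddist E u v ≠ ⊤ := by
    intro ht
    simp [ht] at h
  obtain ⟨k, hk⟩ := ENat.ne_top_iff_exists.mp hne
  obtain ⟨n, hn, hlt⟩ := exists_hasWalk_lt_of_ddist_lt (b := ((k + 1 : ℕ) : ℕ∞)) (by
    rw [← hk]
    exact_mod_cast Nat.lt_succ_self k)
  rw [← hk] at h
  have hk' : 3 * k < D := by exact_mod_cast h
  have hn' : n < k + 1 := by exact_mod_cast hlt
  exact ⟨n, hn, by omega⟩

theorem le_three_mul_ddist_or {V : Type*} {E : V → V → Prop} {D : ℕ} {u v : V} (w : V)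
    (h : (D : ℕ∞) ≤ ddist E v u) :
    (D : ℕ∞) ≤ 3 * ddist E w u ∨ (D : ℕ∞) ≤ 3 * ddist E v w := by
  by_contra! hc
  obtain ⟨m, hm, hmD⟩ := exists_hasWalk_of_three_mul_ddist_lt hc.1
  obtain ⟨n, hn, hnD⟩ := exists_hasWalk_of_three_mul_ddist_lt hc.2
  have hle : D ≤ n + m := by exact_mod_cast h.trans (ddist_le_of_hasWalk (hn.append hm))
  omega

theorem le_three_mul_min {D a b : ℕ∞} (ha : D ≤ 3 * a) (hb : D ≤ 3 * b) :
    D ≤ 3 * min a b := by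
  rcases min_choice a b with h | h <;> rwa [h]

/-- Let `G` be a directed graph, `D ≥ 0` an integer, and `u, v, w` vertices with
`d(v→u) ≥ D`, `3·d(u→w) ≥ D` and `3·d(w→v) ≥ D`.  Then
`3·min{d(u→w), d(w→u)} ≥ D` or `3·min{d(w→v), d(v→w)} ≥ D`; in particular the
min-eccentricity of `w` is at least `D/3`. -/
theorem stmt_11 {V : Type*} (E : V → V → Prop) (D : ℕ) (u v w : V)
    (h1 : (D : ℕ∞) ≤ ddist E v u)
    (h2 : (D : ℕ∞) ≤ 3 * ddist E u w)
    (h3 : (D : ℕ∞) ≤ 3 * ddist E w v) :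
    ((D : ℕ∞) ≤ 3 * min (ddist E u w) (ddist E w u) ∨
      (D : ℕ∞) ≤ 3 * min (ddist E w v) (ddist E v w)) ∧
    (D : ℕ∞) ≤ 3 * ⨆ x : V, min (ddist E w x) (ddist E x w) := by
  have key : (D : ℕ∞) ≤ 3 * min (ddist E u w) (ddist E w u) ∨
      (D : ℕ∞) ≤ 3 * min (ddist E w v) (ddist E v w) :=
    (le_three_mul_ddist_or w h1).imp (le_three_mul_min h2) (le_three_mul_min h3)
  refine ⟨key, ?_⟩
  rcases key with h | h
  · rw [min_comm] at h
    exact h.trans (mul_le_mul_right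
      (le_iSup (fun x : V => min (ddist E w x) (ddist E x w)) u) 3)
  · exact h.trans (mul_le_mul_right
      (le_iSup (fun x : V => min (ddist E w x) (ddist E x w)) v) 3)
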